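/- For every fixed positive integer k, the k-th moment of y_m satisfies 𝔼(y_m^k) = 1/M_m^k + O(1/M_m^{k+2}) as m → ∞. -/

import Mathlib

open MeasureTheory Filter Finset Asymptotics
open scoped Classical

/-- `y_m(α) = ∏_{j ∈ α, j < m} (1 - 1/j)` (empty product = 1). -/
noncomputable def hawkinsY (A : Set ℕ) (m : ℕ) : ℝ :=
  ∏ j ∈ Finset.range m, if j ∈ A then 1 - 1 / (j : ℝ) else 1

/-- The σ-algebra generated by the events `{j ∈ α}` for `2 ≤ j < m`. -/
def sieveSigma {Ω : Type*} (α : Ω → Set ℕ) (m : ℕ) : MeasurableSpace Ω :=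
  MeasurableSpace.generateFrom {s | ∃ j : ℕ, 2 ≤ j ∧ j < m ∧ s = {ω | j ∈ α ω}}

/-- Wunderlich's model of the Hawkins random sieve: a probability space `(Ω, μ)` with a
random subset `α` of `{2,3,4,…}` such that `μ(2 ∈ α) = 1` and, for every `m ≥ 2`, the
conditional probability of `{m ∈ α}` given the σ-algebra generated by the events
`{j ∈ α}`, `2 ≤ j < m`, equals `y_m(α)`. -/
structure IsHawkinsSieve {Ω : Type*} [MeasurableSpace Ω] (μ : Measure Ω)
    (α : Ω → Set ℕ) : Prop where
  isProb : IsProbabilityMeasure μ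
  meas : ∀ n : ℕ, MeasurableSet {ω | n ∈ α ω}
  mem_ge_two : ∀ ω, ∀ n ∈ α ω, 2 ≤ n
  two_mem : μ {ω | 2 ∈ α ω} = 1
  condExp_mem : ∀ m : ℕ, 2 ≤ m →
    μ[Set.indicator {ω | m ∈ α ω} (fun _ => (1 : ℝ)) | sieveSigma α m]
      =ᵐ[μ] fun ω => hawkinsY (α ω) m

/-- `M_k = 1 + ∑_{j=1}^{k-2} 1/j` (so `M_2 = 1`). -/
noncomputable def Mharm (k : ℕ) : ℝ := 1 + ∑ j ∈ Finset.Icc 1 (k - 2), 1 / (j : ℝ)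

theorem Mharm_two : Mharm 2 = 1 := by simp [Mharm]

theorem Mharm_succ {m : ℕ} (hm : 2 ≤ m) : Mharm (m + 1) = Mharm m + 1 / ((m : ℝ) - 1) := by
  obtain ⟨n, rfl⟩ := Nat.exists_eq_add_of_le' hm
  have h1 : n + 2 + 1 - 2 = n + 1 := by omega
  have h2 : n + 2 - 2 = n := by omega
  rw [Mharm, Mharm, h1, h2, Finset.sum_Icc_succ_top (by omega)]
  push_cast
  rw [show (n : ℝ) + 2 - 1 = n + 1 by ring]
  ring

theorem one_le_Mharm (m : ℕ) : 1 ≤ Mharm m := by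
  have : 0 ≤ ∑ j ∈ Finset.Icc 1 (m - 2), 1 / (j : ℝ) := Finset.sum_nonneg fun j _ => by positivity
  rw [Mharm]
  linarith

theorem Mharm_le_two_add_log {m : ℕ} (hm : 1 ≤ m) : Mharm m ≤ 2 + Real.log m := by
  have h1 : ∑ j ∈ Finset.Icc 1 (m - 2), 1 / (j : ℝ) ≤ ∑ j ∈ Finset.Icc 1 m, 1 / (j : ℝ) :=
    Finset.sum_le_sum_of_subset_of_nonneg (Finset.Icc_subset_Icc_right (by omega))
      fun j _ _ => by positivity
  have h2 := harmonic_le_one_add_log m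
  rw [harmonic_eq_sum_Icc] at h2
  push_cast at h2
  simp only [one_div] at h1
  rw [Mharm]
  simp only [one_div]
  linarith

theorem summable_Mharm_pow_div_sq (r : ℕ) :
    Summable fun m : ℕ => Mharm m ^ r / (m : ℝ) ^ 2 := by
  have hlog : (fun m : ℕ => Mharm m) =O[atTop] fun m : ℕ => Real.log m := by
    refine IsBigO.of_bound 3 ?_
    have h := (Real.tendsto_log_atTop.comp tendsto_natCast_atTop_atTop).eventually_ge_atTop
      (1 : ℝ)
    filter_upwards [h, eventually_ge_atTop 1] with m hm hm1
    simp only [Function.comp] at hm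
    have := Mharm_le_two_add_log hm1
    have := one_le_Mharm m
    rw [Real.norm_of_nonneg (by linarith), Real.norm_of_nonneg (by linarith)]
    linarith
  have hpow : (fun m : ℕ => Real.log m ^ r) =O[atTop] fun m : ℕ => (m : ℝ) ^ (1 / 2 : ℝ) := by
    have h := (isLittleO_log_rpow_rpow_atTop (r : ℝ) (by norm_num : (0 : ℝ) < 1 / 2)).isBigO
    simp only [Real.rpow_natCast] at h
    exact h.comp_tendsto tendsto_natCast_atTop_atTop
  refine summable_of_isBigO_nat (g := fun m : ℕ => (m : ℝ) ^ (-(3 / 2) : ℝ))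
    (Real.summable_nat_rpow.2 (by norm_num)) ?_
  have h := ((hlog.pow r).trans hpow).mul
    (isBigO_refl (fun m : ℕ => ((m : ℝ) ^ 2)⁻¹) atTop)
  refine h.congr' (Eventually.of_forall fun m => (div_eq_mul_inv _ _).symm) ?_
  filter_upwards [eventually_ge_atTop 1] with m hm
  have hm0 : (0 : ℝ) < m := by exact_mod_cast hm
  rw [← Real.rpow_natCast (m : ℝ) 2, ← Real.rpow_neg hm0.le, ← Real.rpow_add hm0]
  norm_num

/-- A nonnegative sequence pulled towards `[0, K]` with summable perturbations is bounded. -/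
theorem exists_bound_of_contracting {V e r : ℕ → ℝ} {K : ℝ} {n₀ : ℕ} (hK : 0 ≤ K)
    (he : Summable e) (he0 : ∀ n, 0 ≤ e n)
    (hr0 : ∀ n ≥ n₀, 0 ≤ r n) (hr1 : ∀ n ≥ n₀, r n ≤ 1)
    (hV : ∀ n ≥ n₀, V (n + 1) ≤ (1 - r n + e n) * V n + r n * K + e n) :
    ∃ B : ℝ, ∀ n ≥ n₀, V n ≤ B := by
  have key : ∀ n ≥ n₀, 1 + max (V n) K ≤
      (1 + max (V n₀) K) * Real.exp (∑ i ∈ Finset.range n, e i) := by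
    intro n hn
    induction n, hn using Nat.le_induction with
    | base =>
      have h1 : 1 ≤ Real.exp (∑ i ∈ Finset.range n₀, e i) :=
        Real.one_le_exp (Finset.sum_nonneg fun i _ => he0 i)
      have := le_max_right (V n₀) K
      nlinarith
    | succ n hn ih =>
      have hVm := le_max_left (V n) K
      have hKm := le_max_right (V n) K
      have hstep : 1 + max (V (n + 1)) K ≤ (1 + e n) * (1 + max (V n) K) := by
        have h0 := he0 n
        have h2 := mul_le_mul_of_nonneg_left hVm (sub_nonneg.2 (hr1 n hn))
        have h3 := mul_le_mul_of_nonneg_left hKm (hr0 n hn)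
        have h4 := mul_le_mul_of_nonneg_left hVm h0
        have h5 := mul_nonneg h0 (hK.trans hKm)
        have h6 := hV n hn
        have : max (V (n + 1)) K ≤ max (V n) K + e n * max (V n) K + e n :=
          max_le (by linarith) (by linarith)
        linarith
      rw [Finset.sum_range_succ, Real.exp_add]
      calc 1 + max (V (n + 1)) K ≤ (1 + e n) * (1 + max (V n) K) := hstep
        _ ≤ Real.exp (e n) * ((1 + max (V n₀) K) * Real.exp (∑ i ∈ Finset.range n, e i)) := by
          refine mul_le_mul ?_ ih (by linarith) (Real.exp_pos _).le
          linarith [Real.add_one_le_exp (e n)]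
        _ = _ := by ring
  refine ⟨(1 + max (V n₀) K) * Real.exp (∑' i, e i), fun n hn => ?_⟩
  have h1 : Real.exp (∑ i ∈ Finset.range n, e i) ≤ Real.exp (∑' i, e i) :=
    Real.exp_le_exp.2 (he.sum_le_tsum _ fun i _ => he0 i)
  have h2 := mul_le_mul_of_nonneg_left h1
    (by linarith [le_max_right (V n₀) K] : 0 ≤ 1 + max (V n₀) K)
  linarith [key n hn, le_max_left (V n) K]

theorem one_sub_pow_le_quadratic {s : ℝ} (hs0 : 0 ≤ s) (hs1 : s ≤ 1) (j : ℕ) :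
    (1 - s) ^ j ≤ 1 - j * s + (j : ℝ) ^ 2 * s ^ 2 := by
  induction j with
  | zero => simp
  | succ j ih =>
    have h := mul_le_mul_of_nonneg_right ih (sub_nonneg.2 hs1)
    have h3 : 0 ≤ (j : ℝ) ^ 2 * s ^ 3 := by positivity
    have h4 : 0 ≤ (j : ℝ) * s ^ 2 := by positivity
    rw [pow_succ]
    push_cast
    nlinarith [sq_nonneg s]

theorem one_add_pow_le_quadratic {t : ℝ} (ht0 : 0 ≤ t) (ht1 : t ≤ 1) (j : ℕ) :
    (1 + t) ^ j ≤ 1 + j * t + 4 ^ j * t ^ 2 := by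
  induction j with
  | zero => nlinarith [sq_nonneg t]
  | succ j ih =>
    have h := mul_le_mul_of_nonneg_right ih (by linarith : 0 ≤ 1 + t)
    have hj : (j : ℝ) ≤ 4 ^ j := by exact_mod_cast (Nat.lt_pow_self (by norm_num : 1 < 4)).le
    have h1 : (j : ℝ) * t ^ 2 ≤ 4 ^ j * t ^ 2 := by gcongr
    have h2 : (4 : ℝ) ^ j * t ^ 2 * t ≤ 4 ^ j * t ^ 2 * 1 := by gcongr
    have h3 : (0 : ℝ) ≤ 4 ^ j * t ^ 2 := by positivity
    rw [pow_succ, pow_succ]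
    push_cast
    nlinarith

theorem pow_mul_one_sub_le {w : ℝ} (hw : 0 ≤ w) (j : ℕ) :
    w ^ j * (1 - w) ≤ 2 ^ (j + 1) - w ^ j := by
  have hwj := pow_nonneg hw j
  rcases le_total w 2 with h | h
  · have h1 : w ^ j ≤ 2 ^ j := by gcongr
    rw [pow_succ]
    nlinarith
  · have : (0 : ℝ) < 2 ^ (j + 1) := by positivity
    nlinarith

/-- The one-step drift of `(1/y - M)²`, weighted by the `j`-th power of the shrinking factor. -/
theorem sq_drift_le {y M s : ℝ} (hy0 : 0 < y) (hy1 : y ≤ 1)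
    (hs0 : 0 < s) (hs1 : s < 1) (j : ℕ) {p : ℝ} (hp : p = s / (1 - s)) :
    (1 - y) * (1 / y - (M + p)) ^ 2
        + y * ((1 / (y * (1 - s)) - (M + p)) ^ 2 * (1 - s) ^ j) ≤
      (1 / y - M) ^ 2 * (1 - j * p * y + ((j : ℝ) ^ 2 + 2 * j) * p ^ 2)
        + p ^ 2 * (1 / y + j) := by
  have h1s : 0 < 1 - s := by linarith
  have hp0 : 0 < p := by rw [hp]; positivity
  have hsp : s = p - p * s := by rw [hp]; field_simp
  have hsp' : s ≤ p := by nlinarith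
  obtain ⟨x, hx⟩ : ∃ x, x = 1 / y := ⟨_, rfl⟩
  have hxy : x * y = 1 := by rw [hx]; field_simp
  have hx1 : 1 ≤ x := by rw [hx]; exact one_le_one_div hy0 hy1
  have hshrink : 1 / (y * (1 - s)) = x * (1 + p) := by
    rw [hx, hp]; field_simp; ring
  rw [hshrink, ← hx]
  obtain ⟨N, hN⟩ : ∃ N, N = x - M := ⟨_, rfl⟩
  obtain ⟨d, hd⟩ : ∃ d, d = 1 - (1 - s) ^ j := ⟨_, rfl⟩
  have hq : (1 - s) ^ j = 1 - d := by rw [hd]; ring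
  have hj : (0 : ℝ) ≤ j := Nat.cast_nonneg j
  have hd0 : 0 ≤ d := by
    have := pow_le_one₀ h1s.le (by linarith : 1 - s ≤ 1) (n := j)
    linarith
  have hdu : d ≤ j * p := by
    have h := one_add_mul_le_pow (by linarith : (-2 : ℝ) ≤ -s) j
    rw [← sub_eq_add_neg] at h
    have := mul_le_mul_of_nonneg_left hsp' hj
    linarith
  have hdl : j * p - (j + (j : ℝ) ^ 2) * p ^ 2 ≤ d := by
    have h := one_sub_pow_le_quadratic hs0.le hs1.le j
    have h1 : (j : ℝ) ^ 2 * s ^ 2 ≤ (j : ℝ) ^ 2 * p ^ 2 := by gcongr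
    have h2 : (j : ℝ) * (p - p ^ 2) ≤ j * s := by
      gcongr
      linarith [mul_le_mul_of_nonneg_left hsp' hp0.le]
    linarith
  have hE : (1 - y) * (x - (M + p)) ^ 2 + y * ((x * (1 + p) - (M + p)) ^ 2 * (1 - s) ^ j) =
      N ^ 2 + p ^ 2 * (x - 1) - d * (y * (N + p * (x - 1)) ^ 2) := by
    rw [hq, hN]
    linear_combination (2 * p * (x - M - p) + p ^ 2 * x) * hxy
  have hsq : y * N ^ 2 - p * (1 + N ^ 2) ≤ y * (N + p * (x - 1)) ^ 2 := by
    have h1 : y * (N + p * (x - 1)) ^ 2 =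
        y * N ^ 2 + 2 * N * p * (1 - y) + y * (p * (x - 1)) ^ 2 := by
      linear_combination 2 * N * p * hxy
    have h2 : 0 ≤ y * (p * (x - 1)) ^ 2 := by positivity
    have h3 : 0 ≤ p * (1 - y) * (N + 1) ^ 2 := by
      have : 0 ≤ 1 - y := by linarith
      positivity
    have h4 : 0 ≤ p * y * (1 + N ^ 2) := by positivity
    rw [h1]
    linarith
  have hmul := mul_le_mul_of_nonneg_left hsq hd0
  have h5 := mul_le_mul_of_nonneg_right hdl (by positivity : 0 ≤ y * N ^ 2)
  have h6 := mul_le_mul_of_nonneg_right hdu (by positivity : 0 ≤ p * (1 + N ^ 2))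
  have h7 : (j + (j : ℝ) ^ 2) * p ^ 2 * N ^ 2 * y ≤ (j + (j : ℝ) ^ 2) * p ^ 2 * N ^ 2 * 1 := by
    gcongr
  have h8 : 0 ≤ p ^ 2 := sq_nonneg p
  rw [hE, ← hN]
  linarith

theorem weighted_sq_drift_le {y M s : ℝ} (hy0 : 0 < y) (hy1 : y ≤ 1) (hM : 1 ≤ M)
    (hs0 : 0 < s) (hs1 : s < 1) (j : ℕ) {p B C : ℝ} (hp : p = s / (1 - s)) (hp1 : p ≤ 1)
    (hB : B = (j : ℝ) ^ 2 + 2 * j) (hC : C = B + j * B + 4 ^ j * (1 + B)) :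
    (1 - y) * ((1 / y - (M + p)) ^ 2 * ((M + p) * y) ^ j)
        + y * ((1 / (y * (1 - s)) - (M + p)) ^ 2 * ((M + p) * (y * (1 - s))) ^ j) ≤
      (1 - j * p / M + C * p ^ 2) * ((1 / y - M) ^ 2 * (M * y) ^ j)
        + j * p / M * 2 ^ (j + 1) * (1 / y - M) ^ 2
        + (M + p) ^ j * p ^ 2 * (1 / y + j) := by
  have h1s : 0 < 1 - s := by linarith
  have hp0 : 0 < p := by rw [hp]; positivity
  have hM0 : 0 < M := by linarith
  have hj : (0 : ℝ) ≤ j := Nat.cast_nonneg j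
  have hB0 : 0 ≤ B := by rw [hB]; positivity
  have hdrift := sq_drift_le (M := M) hy0 hy1 hs0 hs1 j hp
  rw [← hB] at hdrift
  obtain ⟨X, hX⟩ : ∃ X, X = (1 / y - M) ^ 2 := ⟨_, rfl⟩
  have hX0 : 0 ≤ X := hX ▸ sq_nonneg _
  rw [← hX] at hdrift ⊢
  have hMy : 0 ≤ (M + p) ^ j * y ^ j := by positivity
  have h1 := mul_le_mul_of_nonneg_left hdrift hMy
  have h2 : (M + p) ^ j * y ^ j * (p ^ 2 * (1 / y + j)) ≤ (M + p) ^ j * p ^ 2 * (1 / y + j) := by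
    have : (M + p) ^ j * p ^ 2 * (1 / y + j) * y ^ j ≤ (M + p) ^ j * p ^ 2 * (1 / y + j) * 1 := by
      gcongr
      exact pow_le_one₀ hy0.le hy1
    linarith
  obtain ⟨a, ha⟩ : ∃ a, a = j * p / M := ⟨_, rfl⟩
  have ha0 : 0 ≤ a := by rw [ha]; positivity
  have haj : a ≤ j := by
    rw [ha, div_le_iff₀ hM0]
    exact mul_le_mul_of_nonneg_left (hp1.trans hM) hj
  obtain ⟨b, hb⟩ : ∃ b, b = j * p * y := ⟨_, rfl⟩
  have hb0 : 0 ≤ b := by rw [hb]; positivity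
  have hbp : b ^ 2 ≤ B * p ^ 2 := by
    have : (y : ℝ) ^ 2 ≤ 1 := pow_le_one₀ hy0.le hy1
    rw [hb, hB]
    linarith [mul_le_mul_of_nonneg_left this (by positivity : 0 ≤ (j : ℝ) ^ 2 * p ^ 2),
      mul_nonneg hj (sq_nonneg p)]
  have hab : a * (M * y) = b := by rw [ha, hb]; field_simp
  have hfac0 : 0 ≤ 1 - b + B * p ^ 2 := by
    linarith [sq_nonneg (1 - b / 2), sq_nonneg b]
  have hgrow : (M + p) ^ j ≤ M ^ j * (1 + a + 4 ^ j * p ^ 2) := by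
    have ht := one_add_pow_le_quadratic (by positivity : 0 ≤ p / M)
      ((div_le_one hM0).2 (hp1.trans hM)) j
    have h3 : (p / M) ^ 2 ≤ p ^ 2 := by
      have : p / M ≤ p := div_le_self hp0.le hM
      gcongr
    have h4 : (4 : ℝ) ^ j * (p / M) ^ 2 ≤ 4 ^ j * p ^ 2 := by gcongr
    have h5 : (M + p) ^ j = M ^ j * (1 + p / M) ^ j := by
      rw [← mul_pow]; congr 1; field_simp
    rw [h5]
    gcongr
    rw [ha, mul_div_assoc]
    linarith
  have hfac : (1 + a + 4 ^ j * p ^ 2) * (1 - b + B * p ^ 2) ≤ 1 + a - b + C * p ^ 2 := by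
    have h4 : (0 : ℝ) ≤ 4 ^ j := by positivity
    have hp2 : p ^ 2 ≤ 1 := pow_le_one₀ hp0.le hp1
    have t1 : 0 ≤ a * b := mul_nonneg ha0 hb0
    have t2 : a * (B * p ^ 2) ≤ j * (B * p ^ 2) := by gcongr
    have t3 : 0 ≤ 4 ^ j * p ^ 2 * b := by positivity
    have t4 : 4 ^ j * p ^ 2 * (B * p ^ 2) ≤ 4 ^ j * p ^ 2 * (B * 1) := by gcongr
    rw [hC]
    linarith
  have hmain : (M + p) ^ j * y ^ j * (X * (1 - b + B * p ^ 2)) ≤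
      (1 - a + C * p ^ 2) * (X * (M * y) ^ j) + a * 2 ^ (j + 1) * X := by
    have hw := pow_mul_one_sub_le (by positivity : 0 ≤ M * y) j
    calc (M + p) ^ j * y ^ j * (X * (1 - b + B * p ^ 2))
        ≤ M ^ j * (1 + a + 4 ^ j * p ^ 2) * y ^ j * (X * (1 - b + B * p ^ 2)) := by gcongr
      _ = X * (M * y) ^ j * ((1 + a + 4 ^ j * p ^ 2) * (1 - b + B * p ^ 2)) := by
        rw [mul_pow]; ring
      _ ≤ X * (M * y) ^ j * (1 + a - b + C * p ^ 2) := by gcongr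
      _ = X * (M * y) ^ j * (1 + C * p ^ 2) + a * X * ((M * y) ^ j * (1 - M * y)) := by
        rw [← hab]; ring
      _ ≤ X * (M * y) ^ j * (1 + C * p ^ 2) + a * X * (2 ^ (j + 1) - (M * y) ^ j) := by gcongr
      _ = _ := by ring
  rw [← ha]
  rw [← hb] at h1
  simp only [mul_pow]
  simp only [mul_pow] at hmain
  linarith

theorem pow_taylor_bounds {w : ℝ} (hw : 0 < w) (k : ℕ) {K : ℕ} (hk : k ≤ K) :
    0 ≤ w ^ k - 1 + k * (1 / w - 1) ∧
      w ^ k - 1 + k * (1 / w - 1) ≤ k * K * ((1 / w - 1) ^ 2 * (1 + w ^ K)) := by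
  induction k with
  | zero => simp
  | succ k ih =>
    obtain ⟨ih0, ih1⟩ := ih (by omega)
    have hgeom : (w - 1) * ∑ i ∈ Finset.range (k + 1), w ^ i = w ^ (k + 1) - 1 := by
      rw [mul_comm, geom_sum_mul]
    have hdiff : w ^ (k + 1) - 1 + ((k : ℝ) + 1) * (1 / w - 1) =
        (w ^ k - 1 + k * (1 / w - 1)) +
          (1 / w - 1) ^ 2 * (w * ∑ i ∈ Finset.range (k + 1), w ^ i) := by
      have : (1 / w - 1) ^ 2 * (w * ∑ i ∈ Finset.range (k + 1), w ^ i) =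
          (w - 1) * ((w - 1) * ∑ i ∈ Finset.range (k + 1), w ^ i) / w := by
        field_simp; ring
      rw [this, hgeom]
      field_simp
      ring
    have hsum0 : 0 ≤ w * ∑ i ∈ Finset.range (k + 1), w ^ i := by positivity
    have hsum : w * ∑ i ∈ Finset.range (k + 1), w ^ i ≤ K * (1 + w ^ K) := by
      rw [Finset.mul_sum]
      have hle : ∀ i ∈ Finset.range (k + 1), w * w ^ i ≤ 1 + w ^ K := by
        intro i hi
        rw [← pow_succ']
        have hi' : i + 1 ≤ K := by have := Finset.mem_range.1 hi; omega
        rcases le_total w 1 with h | h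
        · have := pow_le_one₀ hw.le h (n := i + 1)
          have := pow_pos hw K
          linarith
        · have := pow_le_pow_right₀ h hi'
          linarith
      refine (Finset.sum_le_card_nsmul _ _ _ hle).trans ?_
      rw [Finset.card_range, nsmul_eq_mul]
      have : ((k + 1 : ℕ) : ℝ) ≤ K := by exact_mod_cast hk
      gcongr
    have hmul := mul_le_mul_of_nonneg_left hsum (sq_nonneg (1 / w - 1))
    push_cast
    rw [hdiff]
    refine ⟨add_nonneg ih0 (mul_nonneg (sq_nonneg _) hsum0), ?_⟩
    linarith

theorem hawkinsY_succ (A : Set ℕ) (m : ℕ) :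
    hawkinsY A (m + 1) = if m ∈ A then hawkinsY A m * (1 - 1 / (m : ℝ)) else hawkinsY A m := by
  rw [hawkinsY, Finset.prod_range_succ, ← hawkinsY]
  split_ifs <;> simp

theorem hawkinsY_pos {A : Set ℕ} (hA : ∀ n ∈ A, 2 ≤ n) (m : ℕ) : 0 < hawkinsY A m := by
  refine Finset.prod_pos fun j _ => ?_
  split_ifs with hj
  · have : (2 : ℝ) ≤ j := by exact_mod_cast hA j hj
    rw [sub_pos, div_lt_one (by linarith)]
    linarith
  · norm_num

theorem hawkinsY_le_one {A : Set ℕ} (hA : ∀ n ∈ A, 2 ≤ n) (m : ℕ) : hawkinsY A m ≤ 1 := by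
  refine Finset.prod_le_one (fun j _ => ?_) (fun j _ => ?_)
  · split_ifs with hj
    · have : (2 : ℝ) ≤ j := by exact_mod_cast hA j hj
      rw [sub_nonneg, div_le_one (by linarith)]
      linarith
    · norm_num
  · split_ifs
    · have : (0 : ℝ) ≤ 1 / j := by positivity
      linarith
    · norm_num

theorem hawkinsY_two {A : Set ℕ} (hA : ∀ n ∈ A, 2 ≤ n) : hawkinsY A 2 = 1 := by
  refine Finset.prod_eq_one fun j hj => if_neg fun hjA => ?_
  have := hA j hjA
  have := Finset.mem_range.1 hj
  omega

theorem finite_range_hawkinsY (m : ℕ) : (Set.range fun A => hawkinsY A m).Finite := by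
  refine ((Finset.range m).powerset.finite_toSet.image fun s : Finset ℕ =>
    hawkinsY (s : Set ℕ) m).subset ?_
  rintro _ ⟨A, rfl⟩
  refine ⟨(Finset.range m).filter (· ∈ A),
    Finset.mem_coe.2 (Finset.mem_powerset.2 (Finset.filter_subset _ _)), ?_⟩
  refine Finset.prod_congr rfl fun j hj => ?_
  simp [Finset.mem_range.1 hj]

namespace IsHawkinsSieve

variable {Ω : Type*} [MeasurableSpace Ω] {μ : Measure Ω} {α : Ω → Set ℕ}

theorem sieveSigma_le (h : IsHawkinsSieve μ α) (m : ℕ) :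
    sieveSigma α m ≤ ‹MeasurableSpace Ω› := by
  refine MeasurableSpace.generateFrom_le ?_
  rintro _ ⟨j, -, -, rfl⟩
  exact h.meas j

theorem measurable_hawkinsY (h : IsHawkinsSieve μ α) (m : ℕ) :
    Measurable[sieveSigma α m] fun ω => hawkinsY (α ω) m := by
  unfold hawkinsY
  refine Finset.measurable_fun_prod _ fun j hj => ?_
  by_cases h2 : 2 ≤ j
  · refine Measurable.ite ?_ measurable_const measurable_const
    exact MeasurableSpace.measurableSet_generateFrom ⟨j, h2, Finset.mem_range.1 hj, rfl⟩
  · have : ∀ ω, j ∉ α ω := fun ω hω => h2 (h.mem_ge_two ω j hω)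
    simp only [this, if_false]
    exact measurable_const

theorem stronglyMeasurable_comp (h : IsHawkinsSieve μ α) {G : ℝ → ℝ} (hG : Measurable G)
    (m : ℕ) : StronglyMeasurable[sieveSigma α m] fun ω => G (hawkinsY (α ω) m) :=
  (hG.comp (h.measurable_hawkinsY m)).stronglyMeasurable

theorem integrable_comp (h : IsHawkinsSieve μ α) {G : ℝ → ℝ} (hG : Measurable G) (m : ℕ) :
    Integrable (fun ω => G (hawkinsY (α ω) m)) μ := by
  have := h.isProb
  obtain ⟨C, hC⟩ := ((finite_range_hawkinsY m).image fun t => ‖G t‖).bddAbove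
  refine Integrable.of_bound
    ((h.stronglyMeasurable_comp hG m).mono (h.sieveSigma_le m)).aestronglyMeasurable C
    (Eventually.of_forall fun ω => hC ⟨_, ⟨α ω, rfl⟩, rfl⟩)

theorem integral_indicator_mul (h : IsHawkinsSieve μ α) {G : ℝ → ℝ} (hG : Measurable G)
    {m : ℕ} (hm : 2 ≤ m) :
    ∫ ω, G (hawkinsY (α ω) m) * Set.indicator {ω | m ∈ α ω} (fun _ => (1 : ℝ)) ω ∂μ =
      ∫ ω, G (hawkinsY (α ω) m) * hawkinsY (α ω) m ∂μ := by
  have := h.isProb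
  have hind : Integrable (Set.indicator {ω | m ∈ α ω} (fun _ => (1 : ℝ))) μ :=
    (integrable_const 1).indicator (h.meas m)
  have hint : Integrable ((fun ω => G (hawkinsY (α ω) m)) *
      Set.indicator {ω | m ∈ α ω} (fun _ => (1 : ℝ))) μ := by
    have := (h.integrable_comp hG m).indicator (h.meas m)
    refine this.congr (Eventually.of_forall fun ω => ?_)
    by_cases hω : ω ∈ {ω | m ∈ α ω} <;> simp [Set.indicator, hω]
  have hc := condExp_mul_of_stronglyMeasurable_left (h.stronglyMeasurable_comp hG m) hint hind
  rw [← integral_condExp (h.sieveSigma_le m)]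
  refine integral_congr_ae ?_
  filter_upwards [hc, h.condExp_mem m hm] with ω h1 h2
  exact h1.trans (by rw [Pi.mul_apply, h2])

/-- The one-step transition formula of the Markov chain `y_m`. -/
theorem integral_comp_succ (h : IsHawkinsSieve μ α) {G : ℝ → ℝ} (hG : Measurable G)
    {m : ℕ} (hm : 2 ≤ m) :
    ∫ ω, G (hawkinsY (α ω) (m + 1)) ∂μ =
      ∫ ω, ((1 - hawkinsY (α ω) m) * G (hawkinsY (α ω) m) +
        hawkinsY (α ω) m * G (hawkinsY (α ω) m * (1 - 1 / (m : ℝ)))) ∂μ := by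
  let D : ℝ → ℝ := fun t => G (t * (1 - 1 / (m : ℝ))) - G t
  have hD : Measurable D := by fun_prop
  have hpt : ∀ ω, G (hawkinsY (α ω) (m + 1)) = G (hawkinsY (α ω) m) +
      D (hawkinsY (α ω) m) * Set.indicator {ω | m ∈ α ω} (fun _ => (1 : ℝ)) ω := by
    intro ω
    rw [hawkinsY_succ]
    by_cases hω : m ∈ α ω <;> simp [Set.indicator, hω, D]
  have hint : Integrable (fun ω => D (hawkinsY (α ω) m) *
      Set.indicator {ω | m ∈ α ω} (fun _ => (1 : ℝ)) ω) μ := by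
    refine ((h.integrable_comp hD m).indicator (h.meas m)).congr
      (Eventually.of_forall fun ω => ?_)
    by_cases hω : ω ∈ {ω | m ∈ α ω} <;> simp [Set.indicator, hω]
  have hint' : Integrable (fun ω => D (hawkinsY (α ω) m) * hawkinsY (α ω) m) μ :=
    h.integrable_comp (G := fun t => D t * t) (by fun_prop) m
  simp only [hpt]
  rw [integral_add (h.integrable_comp hG m) hint, h.integral_indicator_mul hD hm,
    ← integral_add (h.integrable_comp hG m) hint']
  refine integral_congr_ae (Eventually.of_forall fun ω => ?_)
  simp only [D]
  ring

theorem integral_inv (h : IsHawkinsSieve μ α) {m : ℕ} (hm : 2 ≤ m) :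
    ∫ ω, 1 / hawkinsY (α ω) m ∂μ = Mharm m := by
  have := h.isProb
  induction m, hm using Nat.le_induction with
  | base => simp [hawkinsY_two (h.mem_ge_two _), Mharm_two]
  | succ m hm ih =>
    have hG : Measurable fun t : ℝ => 1 / t := by fun_prop
    have hm' : (2 : ℝ) ≤ m := by exact_mod_cast hm
    have hpt : ∀ ω, (1 - hawkinsY (α ω) m) * (1 / hawkinsY (α ω) m) +
        hawkinsY (α ω) m * (1 / (hawkinsY (α ω) m * (1 - 1 / (m : ℝ)))) =
        1 / hawkinsY (α ω) m + 1 / ((m : ℝ) - 1) := by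
      intro ω
      have h0 := (hawkinsY_pos (h.mem_ge_two ω) m).ne'
      have h1 : (m : ℝ) - 1 ≠ 0 := by linarith
      have h2 : (m : ℝ) ≠ 0 := by linarith
      have h3 : (1 : ℝ) - 1 / m = (m - 1) / m := by field_simp
      rw [h3]
      field_simp
      ring
    rw [h.integral_comp_succ hG hm, Mharm_succ hm]
    simp only [hpt]
    rw [integral_add (h.integrable_comp hG m) (integrable_const _), ih]
    simp

theorem measurable_weighted_sq (M : ℝ) (j : ℕ) :
    Measurable fun t : ℝ => (1 / t - M) ^ 2 * (M * t) ^ j := by fun_prop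

theorem weighted_variance_succ_le (h : IsHawkinsSieve μ α) (j : ℕ) :
    ∃ D : ℝ, 0 ≤ D ∧ ∀ m : ℕ, 2 ≤ m →
      ∫ ω, (1 / hawkinsY (α ω) (m + 1) - Mharm (m + 1)) ^ 2 *
          (Mharm (m + 1) * hawkinsY (α ω) (m + 1)) ^ j ∂μ ≤
        (1 - j / ((m - 1) * Mharm m) + D * (Mharm m ^ (j + 1) / (m : ℝ) ^ 2)) *
            ∫ ω, (1 / hawkinsY (α ω) m - Mharm m) ^ 2 * (Mharm m * hawkinsY (α ω) m) ^ j ∂μ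
          + j / ((m - 1) * Mharm m) *
            (2 ^ (j + 1) * ∫ ω, (1 / hawkinsY (α ω) m - Mharm m) ^ 2 ∂μ)
          + D * (Mharm m ^ (j + 1) / (m : ℝ) ^ 2) := by
  have := h.isProb
  obtain ⟨B, hB⟩ : ∃ B : ℝ, B = (j : ℝ) ^ 2 + 2 * j := ⟨_, rfl⟩
  obtain ⟨C, hC⟩ : ∃ C : ℝ, C = B + j * B + 4 ^ j * (1 + B) := ⟨_, rfl⟩
  have hB0 : 0 ≤ B := by rw [hB]; positivity
  have hC0 : 0 ≤ C := by rw [hC]; positivity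
  refine ⟨4 * (C + 2 ^ j * (1 + j)), by positivity, fun m hm => ?_⟩
  have hm' : (2 : ℝ) ≤ m := by exact_mod_cast hm
  have hm1 : (0 : ℝ) < m - 1 := by linarith
  have hm0 : (0 : ℝ) < m := by linarith
  obtain ⟨M, hMdef⟩ : ∃ M, M = Mharm m := ⟨_, rfl⟩
  have hM : 1 ≤ M := hMdef ▸ one_le_Mharm m
  have hM0 : 0 < M := by linarith
  obtain ⟨p, hpdef⟩ : ∃ p, p = 1 / ((m : ℝ) - 1) := ⟨_, rfl⟩
  have hp0 : 0 < p := by rw [hpdef]; positivity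
  have hp1 : p ≤ 1 := by rw [hpdef, div_le_one hm1]; linarith
  have hps : p = 1 / (m : ℝ) / (1 - 1 / (m : ℝ)) := by
    rw [hpdef, one_sub_div hm0.ne']
    field_simp
  have hp2 : p ^ 2 ≤ 4 / (m : ℝ) ^ 2 := by
    have : p ≤ 2 / m := by
      rw [hpdef, div_le_div_iff₀ hm1 hm0]
      linarith
    calc p ^ 2 ≤ (2 / m) ^ 2 := by gcongr
      _ = _ := by rw [div_pow]; norm_num
  have hs1 : 1 / (m : ℝ) < 1 := by rw [div_lt_one hm0]; linarith
  rw [Mharm_succ hm, ← hpdef, ← hMdef,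
    h.integral_comp_succ (measurable_weighted_sq (M + p) j) hm]
  have hr : (j : ℝ) / ((m - 1) * M) = j * p / M := by rw [hpdef]; field_simp
  rw [hr]
  obtain ⟨V, hV⟩ : ∃ V, V = ∫ ω, (1 / hawkinsY (α ω) m - M) ^ 2 *
    (M * hawkinsY (α ω) m) ^ j ∂μ := ⟨_, rfl⟩
  have hV0 : 0 ≤ V := by
    rw [hV]
    refine integral_nonneg fun ω => ?_
    have := hawkinsY_pos (h.mem_ge_two ω) m
    simp only [Pi.zero_apply]
    positivity
  have hi1 := h.integrable_comp (measurable_weighted_sq M j) m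
  have hi2 := h.integrable_comp (G := fun t => (1 / t - M) ^ 2) (by fun_prop) m
  have hi3 := h.integrable_comp (G := fun t => 1 / t) (by fun_prop) m
  have hi12 : Integrable (fun ω => (1 - j * p / M + C * p ^ 2) *
      ((1 / hawkinsY (α ω) m - M) ^ 2 * (M * hawkinsY (α ω) m) ^ j) +
      j * p / M * 2 ^ (j + 1) * (1 / hawkinsY (α ω) m - M) ^ 2) μ :=
    (hi1.const_mul _).add (hi2.const_mul _)
  have hi3j : Integrable (fun ω => (M + p) ^ j * p ^ 2 * (1 / hawkinsY (α ω) m + j)) μ :=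
    (hi3.add (integrable_const (j : ℝ))).const_mul _
  have hle := integral_mono
    (h.integrable_comp (G := fun t => (1 - t) * ((1 / t - (M + p)) ^ 2 * ((M + p) * t) ^ j) +
      t * ((1 / (t * (1 - 1 / (m : ℝ))) - (M + p)) ^ 2 *
        ((M + p) * (t * (1 - 1 / (m : ℝ)))) ^ j)) (by fun_prop) m)
    (hi12.add hi3j)
    (fun ω => weighted_sq_drift_le (hawkinsY_pos (h.mem_ge_two ω) m)
      (hawkinsY_le_one (h.mem_ge_two ω) m) hM (by positivity) hs1 j hps hp1 hB hC)
  refine hle.trans ?_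
  simp only [Pi.add_apply]
  rw [integral_add hi12 hi3j,
    integral_add (hi1.const_mul _) (hi2.const_mul _), integral_const_mul, integral_const_mul,
    integral_const_mul, integral_add hi3 (integrable_const _), h.integral_inv hm,
    ← hMdef, ← hV]
  simp only [integral_const, probReal_univ, one_smul]
  have hMj : 1 ≤ M ^ (j + 1) := one_le_pow₀ hM
  have he : C * p ^ 2 ≤ 4 * (C + 2 ^ j * (1 + j)) * (M ^ (j + 1) / (m : ℝ) ^ 2) := by
    calc C * p ^ 2 ≤ (C + 2 ^ j * (1 + j)) * (4 / (m : ℝ) ^ 2) := by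
          gcongr
          have : (0 : ℝ) ≤ 2 ^ j * (1 + j) := by positivity
          linarith
      _ = 4 * (C + 2 ^ j * (1 + j)) * (1 / (m : ℝ) ^ 2) := by ring
      _ ≤ _ := by gcongr
  have hf : (M + p) ^ j * p ^ 2 * (M + j) ≤
      4 * (C + 2 ^ j * (1 + j)) * (M ^ (j + 1) / (m : ℝ) ^ 2) := by
    have hj : (0 : ℝ) ≤ j := Nat.cast_nonneg j
    calc (M + p) ^ j * p ^ 2 * (M + j) ≤ (2 * M) ^ j * (4 / (m : ℝ) ^ 2) * (M * (1 + j)) := by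
          gcongr
          · linarith
          · nlinarith
      _ = 4 * (2 ^ j * (1 + j)) * (M ^ (j + 1) / (m : ℝ) ^ 2) := by ring
      _ ≤ _ := by
        gcongr
        linarith
  have heV := mul_le_mul_of_nonneg_right he hV0
  linarith

theorem weighted_variance_bounded_of_bounded (h : IsHawkinsSieve μ α) (j : ℕ) {K : ℝ}
    {n₀ : ℕ} (hK0 : 0 ≤ K)
    (hK : ∀ m ≥ n₀, j * ∫ ω, (1 / hawkinsY (α ω) m - Mharm m) ^ 2 ∂μ ≤ j * K) :
    ∃ (B : ℝ) (n₁ : ℕ), ∀ m ≥ n₁, ∫ ω, (1 / hawkinsY (α ω) m - Mharm m) ^ 2 *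
      (Mharm m * hawkinsY (α ω) m) ^ j ∂μ ≤ B := by
  obtain ⟨D, hD0, hD⟩ := h.weighted_variance_succ_le j
  have hM : ∀ m, 0 < Mharm m := fun m => by linarith [one_le_Mharm m]
  have hm1 : ∀ m ≥ n₀ + j + 2, (j : ℝ) + 1 ≤ m - 1 := fun m hm => by
    have : ((j + 2 : ℕ) : ℝ) ≤ m := by exact_mod_cast (by omega : j + 2 ≤ m)
    push_cast at this
    linarith
  have hj : (0 : ℝ) ≤ j := Nat.cast_nonneg j
  obtain ⟨B, hB⟩ := exists_bound_of_contracting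
    (V := fun m => ∫ ω, (1 / hawkinsY (α ω) m - Mharm m) ^ 2 *
      (Mharm m * hawkinsY (α ω) m) ^ j ∂μ)
    (e := fun m => D * (Mharm m ^ (j + 1) / (m : ℝ) ^ 2))
    (r := fun m => j / ((m - 1) * Mharm m)) (K := 2 ^ (j + 1) * K) (n₀ := n₀ + j + 2)
    (by positivity) ((summable_Mharm_pow_div_sq (j + 1)).mul_left D)
    (fun m => by have := hM m; positivity)
    (fun m hm => div_nonneg hj (mul_nonneg (by linarith [hm1 m hm]) (hM m).le))
    (fun m hm => by
      have h1 := hm1 m hm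
      have h2 := one_le_Mharm m
      exact div_le_one_of_le₀ (by nlinarith) (mul_nonneg (by linarith) (hM m).le))
    (fun m hm => by
      refine (hD m (by omega)).trans ?_
      have h1 := hm1 m hm
      have hc : 0 ≤ 2 ^ (j + 1) / ((m - 1) * Mharm m) :=
        div_nonneg (by positivity) (mul_nonneg (by linarith) (hM m).le)
      have h2 := mul_le_mul_of_nonneg_left (hK m (by omega)) hc
      have h3 : ∀ z : ℝ, j / ((m - 1) * Mharm m) * (2 ^ (j + 1) * z) =
          2 ^ (j + 1) / ((m - 1) * Mharm m) * (j * z) := fun z => by ring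
      rw [h3, h3]
      linarith)
  exact ⟨B, _, hB⟩

theorem variance_bounded (h : IsHawkinsSieve μ α) :
    ∃ (B : ℝ) (n₁ : ℕ), ∀ m ≥ n₁, ∫ ω, (1 / hawkinsY (α ω) m - Mharm m) ^ 2 ∂μ ≤ B := by
  simpa using h.weighted_variance_bounded_of_bounded 0 (n₀ := 0) le_rfl (by simp)

theorem weighted_variance_bounded (h : IsHawkinsSieve μ α) (j : ℕ) :
    ∃ (B : ℝ) (n₁ : ℕ), ∀ m ≥ n₁, ∫ ω, (1 / hawkinsY (α ω) m - Mharm m) ^ 2 *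
      (Mharm m * hawkinsY (α ω) m) ^ j ∂μ ≤ B := by
  obtain ⟨K, n₀, hK⟩ := h.variance_bounded
  refine h.weighted_variance_bounded_of_bounded j (K := max K 0) (n₀ := n₀) (le_max_right _ _)
    fun m hm => ?_
  have := (hK m hm).trans (le_max_left K 0)
  gcongr

end IsHawkinsSieve

theorem hawkinsY_moments (k : ℕ) (hk : 0 < k) {Ω : Type*} [MeasurableSpace Ω]
    (μ : Measure Ω) (α : Ω → Set ℕ) (h : IsHawkinsSieve μ α) :
    (fun m : ℕ => (∫ ω, (hawkinsY (α ω) m) ^ k ∂μ) - 1 / (Mharm m) ^ k)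
      =O[atTop] fun m : ℕ => 1 / (Mharm m) ^ (k + 2) := by
  have := h.isProb
  obtain ⟨B, n₀, hB⟩ := h.variance_bounded
  obtain ⟨B', n₁, hB'⟩ := h.weighted_variance_bounded k
  refine IsBigO.of_bound (k * k * (B + B')) ?_
  filter_upwards [eventually_ge_atTop n₀, eventually_ge_atTop n₁, eventually_ge_atTop 2]
    with m hm0 hm1 hm2
  have hBm := hB m hm0
  have hBm' := hB' m hm1
  obtain ⟨M, hM⟩ : ∃ M, M = Mharm m := ⟨_, rfl⟩
  have hinv := h.integral_inv hm2
  rw [← hM] at hBm hBm' hinv ⊢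
  have hM0 : 0 < M := by linarith [hM ▸ one_le_Mharm m]
  have hw : ∀ ω, 0 < M * hawkinsY (α ω) m := fun ω =>
    mul_pos hM0 (hawkinsY_pos (h.mem_ge_two ω) m)
  have hi1 := h.integrable_comp (IsHawkinsSieve.measurable_weighted_sq M k) m
  have hi2 := h.integrable_comp (G := fun t => (1 / t - M) ^ 2) (by fun_prop) m
  have hi3 := h.integrable_comp (G := fun t => 1 / t) (by fun_prop) m
  have hi4 := h.integrable_comp (G := fun t => t ^ k) (by fun_prop) m
  let g : ℝ → ℝ := fun t => (M * t) ^ k - 1 + k * (1 / (M * t) - 1)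
  have hg : Measurable g := by fun_prop
  have hgint : ∫ ω, g (hawkinsY (α ω) m) ∂μ =
      M ^ k * (∫ ω, (hawkinsY (α ω) m) ^ k ∂μ) - 1 := by
    have : ∀ t : ℝ, g t = (M ^ k * t ^ k + k / M * (1 / t)) + (-1 - k) := fun t => by
      simp only [g, mul_pow, one_div, mul_inv]
      ring
    have hi43 : Integrable (fun ω => M ^ k * hawkinsY (α ω) m ^ k +
        k / M * (1 / hawkinsY (α ω) m)) μ := (hi4.const_mul _).add (hi3.const_mul _)
    simp only [this]
    rw [integral_add hi43 (integrable_const _),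
      integral_add (hi4.const_mul _) (hi3.const_mul _), integral_const_mul, integral_const_mul,
      hinv]
    simp only [integral_const, probReal_univ, one_smul]
    field_simp
    ring
  have hlow : 0 ≤ ∫ ω, g (hawkinsY (α ω) m) ∂μ :=
    integral_nonneg fun ω => (pow_taylor_bounds (hw ω) k le_rfl).1
  have hup : ∫ ω, g (hawkinsY (α ω) m) ∂μ ≤ k * k / M ^ 2 * (B + B') := by
    refine (integral_mono (h.integrable_comp hg m) ((hi2.add hi1).const_mul (k * k / M ^ 2))
      fun ω => ?_).trans ?_
    · refine ((pow_taylor_bounds (hw ω) k le_rfl).2).trans_eq ?_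
      have hy := (hawkinsY_pos (h.mem_ge_two ω) m).ne'
      simp only [Pi.add_apply]
      have : (1 / (M * hawkinsY (α ω) m) - 1) = (1 / hawkinsY (α ω) m - M) / M := by
        field_simp
      rw [this, div_pow]
      ring
    · rw [integral_const_mul]
      simp only [Pi.add_apply]
      rw [integral_add hi2 hi1]
      gcongr
  have heq : (∫ ω, (hawkinsY (α ω) m) ^ k ∂μ) - 1 / M ^ k =
      (∫ ω, g (hawkinsY (α ω) m) ∂μ) / M ^ k := by
    rw [hgint]
    field_simp
  rw [heq, Real.norm_of_nonneg (by positivity), Real.norm_of_nonneg (by positivity)]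
  calc (∫ ω, g (hawkinsY (α ω) m) ∂μ) / M ^ k
      ≤ k * k / M ^ 2 * (B + B') / M ^ k := by gcongr
    _ = k * k * (B + B') * (1 / M ^ (k + 2)) := by
      rw [pow_add]
      field_simp
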